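/- For every prime p, g_{(3,2,1,3)}(p) = 5p^4 − 4p^3 + 2p^2, where (3,2,1,3) is the composition of 9 into 4 positive parts with entries 3, 2, 1, 3 in that order (so the corresponding irreducible subring matrices have size n = 5). -/

import Mathlib

/-- `v` lies in the ℤ-span of the columns of the square integer matrix `A`. -/
def InColSpan {n : ℕ} (A : Matrix (Fin n) (Fin n) ℤ) (v : Fin n → ℤ) : Prop :=
  ∃ x : Fin n → ℤ, A.mulVec x = v

/-- `A` is a subring matrix: upper triangular in Hermite normal form (positive
diagonal, `0 ≤ A i j < A i i` for `i < j`), the all-ones vector lies in the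
ℤ-span of the columns, and the componentwise product of any two columns lies in
the ℤ-span of the columns. -/
def IsSubringMatrix {n : ℕ} (A : Matrix (Fin n) (Fin n) ℤ) : Prop :=
  (∀ i j : Fin n, j < i → A i j = 0) ∧
  (∀ i : Fin n, 0 < A i i) ∧
  (∀ i j : Fin n, i < j → 0 ≤ A i j ∧ A i j < A i i) ∧
  InColSpan A (fun _ => 1) ∧
  (∀ j k : Fin n, InColSpan A (fun i => A i j * A i k))

/-- `A` is an irreducible subring matrix for the prime `p` with diagonal
`(p ^ α 0, …, p ^ α (n-1), 1)`: a subring matrix with the prescribed diagonal,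
whose last column has all entries equal to `1`, and all of whose off-diagonal
entries away from the last column are divisible by `p`. -/
def IsIrreducibleSubringMatrix (p : ℕ) {n : ℕ} (α : Fin n → ℕ)
    (A : Matrix (Fin (n + 1)) (Fin (n + 1)) ℤ) : Prop :=
  IsSubringMatrix A ∧
  (∀ i : Fin n, A i.castSucc i.castSucc = (p : ℤ) ^ α i) ∧
  A (Fin.last n) (Fin.last n) = 1 ∧
  (∀ i : Fin (n + 1), A i (Fin.last n) = 1) ∧
  (∀ i j : Fin n, i < j → (p : ℤ) ∣ A i.castSucc j.castSucc)

/-- `gComp p α` : the number of irreducible subring matrices with diagonal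
`(p ^ α 0, …, p ^ α (n-1), 1)`. -/
noncomputable def gComp (p : ℕ) {n : ℕ} (α : Fin n → ℕ) : ℕ :=
  Nat.card {A : Matrix (Fin (n + 1)) (Fin (n + 1)) ℤ // IsIrreducibleSubringMatrix p α A}

/-- `gNum p n e` : the number of irreducible subring matrices of size `n` with
determinant `p ^ e` (so `gNum p 1 0 = 1` and `gNum p 1 e = 0` for `e ≥ 1`). -/
noncomputable def gNum (p : ℕ) : ℕ → ℕ → ℕ
  | 0, _ => 0
  | m + 1, e =>
      Nat.card {A : Matrix (Fin (m + 1)) (Fin (m + 1)) ℤ //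
        (∃ α : Fin m → ℕ, (∀ i, 1 ≤ α i) ∧ IsIrreducibleSubringMatrix p α A) ∧
        A.det = (p : ℤ) ^ e}

/-- The solutions of the system describing the irreducible subring matrices with diagonal
`(p ^ 3, p ^ 2, p, p ^ 3, 1)`, in five pairwise disjoint families. -/
theorem solution_iff {F : Type*} [Field F] (x u v y z : F) :
    (y ^ 2 - y = x * (u ^ 2 - u) ∧ y * z = x * u * v ∧ z ^ 2 = x * v ^ 2) ↔
    ((((((u ≠ 0 ∧ u ≠ 1) ∧ (y ^ 2 - y) / (u ^ 2 - u) = x ∧ v = 0 ∧ z = 0) ∨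
      ((u = 0 ∨ u = 1) ∧ (y = 0 ∨ y = 1) ∧ v = 0 ∧ z = 0)) ∨
      (v ≠ 0 ∧ (y = 0 ∨ y = 1) ∧ x = 0 ∧ z = 0)) ∨
      (v ≠ 0 ∧ x = 1 ∧ y = u ∧ z = v)) ∨
      (v ≠ 0 ∧ ∃ s, (s ≠ 0 ∧ s ≠ 1) ∧ x = s ^ 2 ∧ u = 0 ∧ y = 0 ∧ z = s * v)) := by
  constructor
  · rintro ⟨h1, h2, h3⟩
    by_cases hv : v = 0
    · have hz : z = 0 := by simpa [hv] using h3
      by_cases hu : u = 0 ∨ u = 1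
      · have hu' : u ^ 2 - u = 0 := by rcases hu with rfl | rfl <;> ring
        have hy : y * (y - 1) = 0 := by rw [hu'] at h1; linear_combination h1
        have hy' : y = 0 ∨ y = 1 := by simpa [sub_eq_zero] using hy
        exact Or.inl (Or.inl (Or.inl (Or.inr ⟨hu, hy', hv, hz⟩)))
      · have hu' : u ^ 2 - u ≠ 0 := by
          rw [show u ^ 2 - u = u * (u - 1) by ring]
          rw [not_or] at hu
          exact mul_ne_zero hu.1 (sub_ne_zero.2 hu.2)
        have := (div_eq_iff hu').2 h1
        exact Or.inl (Or.inl (Or.inl (Or.inl ⟨not_or.1 hu, this, hv, hz⟩)))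
    · obtain ⟨s, rfl⟩ : ∃ s, z = s * v := ⟨z / v, by field_simp⟩
      have hx : x = s ^ 2 := by
        apply mul_right_cancel₀ (pow_ne_zero 2 hv)
        linear_combination -h3
      subst hx
      by_cases hs : s = 0
      · subst hs
        have hy : y * (y - 1) = 0 := by linear_combination h1
        have hy' : y = 0 ∨ y = 1 := by simpa [sub_eq_zero] using hy
        simp [hv, hy']
      · have hy : y = s * u := by
          apply mul_right_cancel₀ (mul_ne_zero hs hv)
          linear_combination h2
        subst hy
        have h4 : s * (u * (s - 1)) = 0 := by linear_combination h1
        by_cases hs1 : s = 1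
        · subst hs1
          simp [hv]
        · have hu : u = 0 := by simpa [hs, sub_eq_zero, hs1] using h4
          exact Or.inr ⟨hv, s, ⟨hs, hs1⟩, by simp [hu]⟩
  · rintro ((((⟨⟨hu, hu1⟩, rfl, rfl, rfl⟩ | ⟨hu | hu, hy | hy, rfl, rfl⟩) |
      ⟨hv, hy | hy, rfl, rfl⟩) | ⟨hv, rfl, rfl, rfl⟩) | ⟨hv, s, hs, rfl, rfl, rfl, rfl⟩)
    · have hu' : u ^ 2 - u ≠ 0 := by
        rw [show u ^ 2 - u = u * (u - 1) by ring]
        exact mul_ne_zero hu (sub_ne_zero.2 hu1)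
      exact ⟨(div_mul_cancel₀ _ hu').symm, by ring, by ring⟩
    all_goals (try subst hu); (try subst hy); exact ⟨by ring, by ring, by ring⟩

open Finset in
/-- The number of solutions over a finite field of the system describing the irreducible subring
matrices with diagonal `(p ^ 3, p ^ 2, p, p ^ 3, 1)`. -/
theorem card_solutions (F : Type*) [Field F] [Fintype F] [DecidableEq F] :
    ((univ.filter fun t : F × F × F × F × F =>
      t.2.2.2.1 ^ 2 - t.2.2.2.1 = t.1 * (t.2.1 ^ 2 - t.2.1) ∧
      t.2.2.2.1 * t.2.2.2.2 = t.1 * t.2.1 * t.2.2.1 ∧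
      t.2.2.2.2 ^ 2 = t.1 * t.2.2.1 ^ 2).card : ℤ) =
      5 * (Fintype.card F : ℤ) ^ 2 - 4 * Fintype.card F + 2 := by
  have h01 : (0 : F) ≠ 1 := zero_ne_one
  let T : Finset F := {0, 1}
  have hT : T.card = 2 := card_pair h01
  have hTc : (Tᶜ.card : ℤ) = Fintype.card F - 2 := by
    have := card_add_card_compl T
    omega
  have h0c : (({0} : Finset F)ᶜ.card : ℤ) = Fintype.card F - 1 := by
    have := card_add_card_compl ({0} : Finset F)
    rw [card_singleton] at this
    omega
  have hmem : ∀ a : F, a ∈ T ↔ a = 0 ∨ a = 1 := by simp [T]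
  let A₁ := (Tᶜ ×ˢ (univ : Finset F)).image fun t : F × F =>
    ((t.2 ^ 2 - t.2) / (t.1 ^ 2 - t.1), t.1, (0 : F), t.2, (0 : F))
  let A₂ := (T ×ˢ T ×ˢ (univ : Finset F)).image fun t : F × F × F =>
    (t.2.2, t.1, (0 : F), t.2.1, (0 : F))
  let B₁ := (({0} : Finset F)ᶜ ×ˢ T ×ˢ (univ : Finset F)).image fun t : F × F × F =>
    ((0 : F), t.2.2, t.1, t.2.1, (0 : F))
  let B₂ := (({0} : Finset F)ᶜ ×ˢ (univ : Finset F)).image fun t : F × F =>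
    ((1 : F), t.2, t.1, t.2, t.1)
  let B₃ := (({0} : Finset F)ᶜ ×ˢ Tᶜ).image fun t : F × F =>
    (t.2 ^ 2, (0 : F), t.1, (0 : F), t.2 * t.1)
  have cA₁ : (A₁.card : ℤ) = (Fintype.card F - 2) * Fintype.card F := by
    rw [card_image_of_injective, card_product, card_univ]
    · push_cast; rw [hTc]
    · rintro ⟨a, b⟩ ⟨c, d⟩ h
      simp_all
  have cA₂ : (A₂.card : ℤ) = 4 * Fintype.card F := by
    rw [card_image_of_injective, card_product, card_product, card_univ, hT]
    · push_cast; ring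
    · rintro ⟨a, b, e⟩ ⟨c, d, f⟩ h
      simp_all
  have cB₁ : (B₁.card : ℤ) = (Fintype.card F - 1) * (2 * Fintype.card F) := by
    rw [card_image_of_injective, card_product, card_product, card_univ, hT]
    · push_cast; rw [h0c]
    · rintro ⟨a, b, e⟩ ⟨c, d, f⟩ h
      simp_all
  have cB₂ : (B₂.card : ℤ) = (Fintype.card F - 1) * Fintype.card F := by
    rw [card_image_of_injective, card_product, card_univ]
    · push_cast; rw [h0c]
    · rintro ⟨a, b⟩ ⟨c, d⟩ h
      simp_all
  have cB₃ : (B₃.card : ℤ) = (Fintype.card F - 1) * (Fintype.card F - 2) := by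
    rw [card_image_of_injOn, card_product]
    · push_cast; rw [h0c, hTc]
    · rintro ⟨a, b⟩ hab ⟨c, d⟩ hcd h
      simp only [coe_product, Set.mem_prod, mem_coe, mem_compl, mem_singleton] at hab hcd
      simp only [Prod.mk.injEq] at h ⊢
      obtain ⟨-, -, rfl, -, h⟩ := h
      exact ⟨rfl, mul_right_cancel₀ hab.1 h⟩
  have mA₁ : ∀ x u v y z : F, (x, u, v, y, z) ∈ A₁ ↔
      (u ≠ 0 ∧ u ≠ 1) ∧ (y ^ 2 - y) / (u ^ 2 - u) = x ∧ v = 0 ∧ z = 0 := by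
    intro x u v y z
    simp only [A₁, mem_image, mem_product, mem_compl, hmem, mem_univ, Prod.exists, Prod.mk.injEq]
    constructor
    · rintro ⟨a, b, h, h1, rfl, rfl, rfl, rfl⟩; tauto
    · rintro ⟨h, h1, rfl, rfl⟩; exact ⟨u, y, by tauto⟩
  have mA₂ : ∀ x u v y z : F, (x, u, v, y, z) ∈ A₂ ↔
      (u = 0 ∨ u = 1) ∧ (y = 0 ∨ y = 1) ∧ v = 0 ∧ z = 0 := by
    intro x u v y z
    simp only [A₂, mem_image, mem_product, hmem, mem_univ, Prod.exists, Prod.mk.injEq]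
    constructor
    · rintro ⟨a, b, c, h, rfl, rfl, rfl, rfl, rfl⟩; tauto
    · rintro ⟨h, h1, rfl, rfl⟩; exact ⟨u, y, x, by tauto⟩
  have mB₁ : ∀ x u v y z : F, (x, u, v, y, z) ∈ B₁ ↔
      v ≠ 0 ∧ (y = 0 ∨ y = 1) ∧ x = 0 ∧ z = 0 := by
    intro x u v y z
    simp only [B₁, mem_image, mem_product, mem_compl, mem_singleton, hmem, mem_univ, Prod.exists,
      Prod.mk.injEq]
    constructor
    · rintro ⟨a, b, c, h, rfl, rfl, rfl, rfl, rfl⟩; tauto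
    · rintro ⟨h, h1, rfl, rfl⟩; exact ⟨v, y, u, by tauto⟩
  have mB₂ : ∀ x u v y z : F, (x, u, v, y, z) ∈ B₂ ↔ v ≠ 0 ∧ x = 1 ∧ y = u ∧ z = v := by
    intro x u v y z
    simp only [B₂, mem_image, mem_product, mem_compl, mem_singleton, mem_univ, Prod.exists,
      Prod.mk.injEq]
    constructor
    · rintro ⟨a, b, h, rfl, rfl, rfl, rfl, rfl⟩; tauto
    · rintro ⟨h, rfl, rfl, rfl⟩; exact ⟨z, y, by tauto⟩
  have mB₃ : ∀ x u v y z : F, (x, u, v, y, z) ∈ B₃ ↔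
      v ≠ 0 ∧ ∃ s, (s ≠ 0 ∧ s ≠ 1) ∧ x = s ^ 2 ∧ u = 0 ∧ y = 0 ∧ z = s * v := by
    intro x u v y z
    simp only [B₃, mem_image, mem_product, mem_compl, mem_singleton, hmem, Prod.exists,
      Prod.mk.injEq]
    constructor
    · rintro ⟨a, b, h, rfl, rfl, rfl, rfl, rfl⟩; exact ⟨h.1, b, by tauto⟩
    · rintro ⟨h, s, hs, rfl, rfl, rfl, rfl⟩; exact ⟨v, s, by tauto⟩
  have key : (univ.filter fun t : F × F × F × F × F =>
      t.2.2.2.1 ^ 2 - t.2.2.2.1 = t.1 * (t.2.1 ^ 2 - t.2.1) ∧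
      t.2.2.2.1 * t.2.2.2.2 = t.1 * t.2.1 * t.2.2.1 ∧
      t.2.2.2.2 ^ 2 = t.1 * t.2.2.1 ^ 2) = (((A₁ ∪ A₂) ∪ B₁) ∪ B₂) ∪ B₃ := by
    ext ⟨x, u, v, y, z⟩
    simp only [mem_filter, mem_univ, true_and, mem_union, mA₁, mA₂, mB₁, mB₂, mB₃]
    exact solution_iff x u v y z
  have d₁ : Disjoint A₁ A₂ := by
    rw [disjoint_left]; rintro ⟨x, u, v, y, z⟩; rw [mA₁, mA₂]; tauto
  have d₂ : Disjoint (A₁ ∪ A₂) B₁ := by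
    rw [disjoint_left]; rintro ⟨x, u, v, y, z⟩; rw [mem_union, mA₁, mA₂, mB₁]; tauto
  have d₃ : Disjoint ((A₁ ∪ A₂) ∪ B₁) B₂ := by
    rw [disjoint_left]; rintro ⟨x, u, v, y, z⟩
    rw [mem_union, mem_union, mA₁, mA₂, mB₁, mB₂]
    rintro h ⟨h1, h2, h3, h4⟩
    rw [h4, h2] at h
    have := h01.symm
    tauto
  have d₄ : Disjoint (((A₁ ∪ A₂) ∪ B₁) ∪ B₂) B₃ := by
    rw [disjoint_left]; rintro ⟨x, u, v, y, z⟩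
    rw [mem_union, mem_union, mem_union, mA₁, mA₂, mB₁, mB₂, mB₃]
    rintro h ⟨h1, s, hs, -, -, -, h4⟩
    have hz : z ≠ 0 := h4 ▸ mul_ne_zero hs.1 h1
    have hzv : z ≠ v := fun h5 => hs.2 (mul_right_cancel₀ h1 (by rw [← h4, h5, one_mul]))
    tauto
  rw [key, card_union_of_disjoint d₄, card_union_of_disjoint d₃, card_union_of_disjoint d₂,
    card_union_of_disjoint d₁]
  push_cast
  rw [cA₁, cA₂, cB₁, cB₂, cB₃]
  ring

/-- The matrices with diagonal `(p ^ 3, p ^ 2, p, p ^ 3, 1)` among which all irreducible subring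
matrices with this diagonal occur. -/
def candidate (p x u v y z : ℤ) : Matrix (Fin 5) (Fin 5) ℤ :=
  !![p ^ 3, p ^ 2 * x, p * y, p * z, 1;
     0, p ^ 2, p * u, p * v, 1;
     0, 0, p, 0, 1;
     0, 0, 0, p ^ 3, 1;
     0, 0, 0, 0, 1]

theorem inColSpan_col {n : ℕ} (A : Matrix (Fin n) (Fin n) ℤ) (j : Fin n) :
    InColSpan A fun i => A i j :=
  ⟨Pi.single j 1, by ext i; simp⟩

theorem forall_inColSpan_candidate_iff (p x u v y z : ℤ) (hp : p ≠ 0) :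
    (∀ j k : Fin 5, InColSpan (candidate p x u v y z)
      fun i => candidate p x u v y z i j * candidate p x u v y z i k) ↔
    p ∣ y ^ 2 - y - x * (u ^ 2 - u) ∧ p ∣ y * z - x * u * v ∧ p ∣ z ^ 2 - x * v ^ 2 := by
  constructor
  · intro h
    have h22 := h 2 2
    have h23 := h 2 3
    have h33 := h 3 3
    simp only [InColSpan, candidate, funext_iff, Fin.forall_fin_succ, Matrix.mulVec, dotProduct,
      Fin.sum_univ_succ] at h22 h23 h33
    simp at h22 h23 h33
    obtain ⟨a, a1, a2, a3, a4, a5⟩ := h22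
    obtain ⟨b, b1, b2, b3, b4, b5⟩ := h23
    obtain ⟨c, c1, c2, c3, c4, c5⟩ := h33
    have hp2 : p ^ 2 ≠ 0 := pow_ne_zero 2 hp
    have hp3 : p ^ 3 ≠ 0 := pow_ne_zero 3 hp
    have a3' : a 3 = 0 := by simpa [a5, hp] using a4
    have b3' : b 3 = 0 := by simpa [b5, hp] using b4
    have b2' : b 2 = 0 := by simpa [b5, hp] using b3
    have c2' : c 2 = 0 := by simpa [c5, hp] using c3
    have a2' : a 2 = p := mul_left_cancel₀ hp (by linear_combination a3 - a5)
    have c3' : c 3 = p ^ 3 := mul_left_cancel₀ hp3 (by linear_combination c4 - c5)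
    rw [a3', a2', a5] at a1 a2
    rw [b3', b2', b5] at b1 b2
    rw [c3', c2', c5] at c1 c2
    have a1' : a 1 = u ^ 2 - u := mul_left_cancel₀ hp2 (by linear_combination a2)
    have b1' : b 1 = u * v := mul_left_cancel₀ hp2 (by linear_combination b2)
    have c1' : c 1 = v ^ 2 - p ^ 2 * v := mul_left_cancel₀ hp2 (by linear_combination c2)
    rw [a1'] at a1
    rw [b1'] at b1
    rw [c1'] at c1
    refine ⟨⟨a 0, mul_left_cancel₀ hp2 ?_⟩, ⟨b 0, mul_left_cancel₀ hp2 ?_⟩,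
      ⟨c 0 - p * x * v + p * z, mul_left_cancel₀ hp2 ?_⟩⟩
    · linear_combination -a1
    · linear_combination -b1
    · linear_combination -c1
  · rintro ⟨⟨a, ha⟩, ⟨b, hb⟩, ⟨c, hc⟩⟩
    have symm : ∀ j k : Fin 5, InColSpan (candidate p x u v y z)
      (fun i => candidate p x u v y z i j * candidate p x u v y z i k) →
      InColSpan (candidate p x u v y z)
      (fun i => candidate p x u v y z i k * candidate p x u v y z i j) := by
      intro j k h
      simpa only [mul_comm] using h
    have h00 : ∀ k : Fin 5, InColSpan (candidate p x u v y z)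
        fun i => candidate p x u v y z i 0 * candidate p x u v y z i k := by
      intro k
      refine ⟨Pi.single 0 (candidate p x u v y z 0 k), ?_⟩
      ext i
      fin_cases i <;> simp [candidate, mul_comm]
    have h4 : ∀ k : Fin 5, InColSpan (candidate p x u v y z)
        fun i => candidate p x u v y z i 4 * candidate p x u v y z i k := by
      intro k
      convert inColSpan_col (candidate p x u v y z) k using 2 with i
      fin_cases i <;> simp [candidate]
    have h11 : InColSpan (candidate p x u v y z)
        fun i => candidate p x u v y z i 1 * candidate p x u v y z i 1 := by
      refine ⟨![p * (x ^ 2 - x), p ^ 2, 0, 0, 0], ?_⟩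
      ext i
      fin_cases i <;> simp [candidate, Matrix.mulVec, dotProduct, Fin.sum_univ_succ]
      ring
    have h12 : InColSpan (candidate p x u v y z)
        fun i => candidate p x u v y z i 1 * candidate p x u v y z i 2 := by
      refine ⟨![x * y - u * x, p * u, 0, 0, 0], ?_⟩
      ext i
      fin_cases i <;> simp [candidate, Matrix.mulVec, dotProduct, Fin.sum_univ_succ]
      ring
    have h13 : InColSpan (candidate p x u v y z)
        fun i => candidate p x u v y z i 1 * candidate p x u v y z i 3 := by
      refine ⟨![x * z - v * x, p * v, 0, 0, 0], ?_⟩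
      ext i
      fin_cases i <;> simp [candidate, Matrix.mulVec, dotProduct, Fin.sum_univ_succ]
      ring
    have h22 : InColSpan (candidate p x u v y z)
        fun i => candidate p x u v y z i 2 * candidate p x u v y z i 2 := by
      refine ⟨![a, u ^ 2 - u, p, 0, 0], ?_⟩
      ext i
      fin_cases i <;> simp [candidate, Matrix.mulVec, dotProduct, Fin.sum_univ_succ] <;>
        first | ring1 | linear_combination -p ^ 2 * ha
    have h23 : InColSpan (candidate p x u v y z)
        fun i => candidate p x u v y z i 2 * candidate p x u v y z i 3 := by
      refine ⟨![b, u * v, 0, 0, 0], ?_⟩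
      ext i
      fin_cases i <;> simp [candidate, Matrix.mulVec, dotProduct, Fin.sum_univ_succ] <;>
        first | ring1 | linear_combination -p ^ 2 * hb
    have h33 : InColSpan (candidate p x u v y z)
        fun i => candidate p x u v y z i 3 * candidate p x u v y z i 3 := by
      refine ⟨![c - p * z + p * x * v, v ^ 2 - p ^ 2 * v, 0, p ^ 3, 0], ?_⟩
      ext i
      fin_cases i <;> simp [candidate, Matrix.mulVec, dotProduct, Fin.sum_univ_succ] <;>
        first | ring1 | linear_combination -p ^ 2 * hc
    intro j k
    fin_cases j <;> fin_cases k <;>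
      first
        | exact h00 _ | exact h4 _ | exact symm _ _ (h00 _) | exact symm _ _ (h4 _)
        | exact h11 | exact h12 | exact h13 | exact h22 | exact h23 | exact h33
        | exact symm _ _ h12 | exact symm _ _ h13 | exact symm _ _ h23

theorem isIrreducibleSubringMatrix_candidate {p : ℕ} (hp : p.Prime) {x u v y z : ℤ}
    (hr : (0 ≤ x ∧ x < p) ∧ (0 ≤ u ∧ u < p) ∧ (0 ≤ v ∧ v < p) ∧ (0 ≤ y ∧ y < p ^ 2) ∧
      (0 ≤ z ∧ z < p ^ 2))
    (hc : (p : ℤ) ∣ y ^ 2 - y - x * (u ^ 2 - u) ∧ (p : ℤ) ∣ y * z - x * u * v ∧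
      (p : ℤ) ∣ z ^ 2 - x * v ^ 2) :
    IsIrreducibleSubringMatrix p ![3, 2, 1, 3] (candidate p x u v y z) := by
  have hp0 : (0 : ℤ) < p := by exact_mod_cast hp.pos
  have hp2 : (0 : ℤ) < p ^ 2 := pow_pos hp0 2
  obtain ⟨⟨hx, hx'⟩, ⟨hu, hu'⟩, ⟨hv, hv'⟩, ⟨hy, hy'⟩, ⟨hz, hz'⟩⟩ := hr
  refine ⟨⟨?_, ?_, ?_, ?_, ?_⟩, ?_, ?_, ?_, ?_⟩
  · simp [Fin.forall_fin_succ, candidate]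
  · simp [Fin.forall_fin_succ, candidate, hp.pos]
  · have hp1 : (1 : ℤ) < p := by exact_mod_cast hp.one_lt
    have hp1' : (1 : ℤ) < p ^ 3 := one_lt_pow₀ hp1 (by norm_num)
    simp [Fin.forall_fin_succ, candidate, hp.pos, *]
    have hsq : ∀ a : ℤ, a < p → p * a < (p : ℤ) ^ 2 := fun a ha => by
      rw [sq]
      exact mul_lt_mul_of_pos_left ha hp0
    have hcube : ∀ a : ℤ, a < p ^ 2 → p * a < (p : ℤ) ^ 3 := fun a ha => by
      rw [pow_succ' _ 2]
      exact mul_lt_mul_of_pos_left ha hp0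
    refine ⟨⟨?_, hcube y hy', hcube z hz'⟩, hsq u hu', hsq v hv'⟩
    rw [pow_succ _ 2]
    exact mul_lt_mul_of_pos_left hx' hp2
  · convert inColSpan_col (candidate p x u v y z) 4 using 2 with i
    fin_cases i <;> simp [candidate]
  · exact (forall_inColSpan_candidate_iff _ _ _ _ _ _ hp0.ne').2 hc
  · simp [Fin.forall_fin_succ, candidate]
  · simp [candidate]
  · simp [Fin.forall_fin_succ, candidate]
  · simp [Fin.forall_fin_succ, candidate]
    exact (dvd_pow_self _ two_ne_zero).mul_right x

/-- The irreducible subring matrices with diagonal `(p ^ 3, p ^ 2, p, p ^ 3, 1)`, in coordinates. -/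
theorem isIrreducibleSubringMatrix_iff {p : ℕ} (hp : p.Prime) (A : Matrix (Fin 5) (Fin 5) ℤ) :
    IsIrreducibleSubringMatrix p ![3, 2, 1, 3] A ↔ ∃ x u v y z : ℤ,
      ((0 ≤ x ∧ x < p) ∧ (0 ≤ u ∧ u < p) ∧ (0 ≤ v ∧ v < p) ∧ (0 ≤ y ∧ y < p ^ 2) ∧
        (0 ≤ z ∧ z < p ^ 2)) ∧
      ((p : ℤ) ∣ y ^ 2 - y - x * (u ^ 2 - u) ∧ (p : ℤ) ∣ y * z - x * u * v ∧
        (p : ℤ) ∣ z ^ 2 - x * v ^ 2) ∧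
      A = candidate p x u v y z := by
  have hp0 : (0 : ℤ) < p := by exact_mod_cast hp.pos
  have hp2 : (0 : ℤ) < p ^ 2 := pow_pos hp0 2
  have hp3 : (0 : ℤ) < p ^ 3 := pow_pos hp0 3
  constructor
  · rintro ⟨⟨hlow, -, hred, -, hmul⟩, hdiag, -, hlast, hdvd⟩
    have h11 := hmul 1 1
    simp only [InColSpan, funext_iff, Fin.forall_fin_succ, Matrix.mulVec, dotProduct,
      Fin.sum_univ_succ] at h11
    simp at h11
    simp [Fin.forall_fin_succ] at hlow hred hdiag hlast hdvd
    obtain ⟨l10, ⟨l20, l21⟩, ⟨l30, l31, l32⟩, l40, l41, l42, l43⟩ := hlow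
    obtain ⟨⟨⟨r01, r01'⟩, ⟨r02, r02'⟩, ⟨r03, r03'⟩, -⟩, ⟨⟨r12, r12'⟩, ⟨r13, r13'⟩, -⟩,
      ⟨⟨r23, r23'⟩, -⟩, -⟩ := hred
    obtain ⟨d0, d1, d2, d3⟩ := hdiag
    obtain ⟨e0, e1, e2, e3, e4⟩ := hlast
    obtain ⟨⟨⟨x', hx'⟩, ⟨y, hy⟩, ⟨z, hz⟩⟩, ⟨⟨u, hu⟩, ⟨v, hv⟩⟩, ⟨w, hw⟩⟩ := hdvd
    rw [d0] at r01' r02' r03'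
    rw [d1] at r12' r13'
    rw [d2] at r23'
    have hw0 : w = 0 := by
      rw [hw] at r23 r23'
      nlinarith [nonneg_of_mul_nonneg_right r23 hp0,
        (mul_lt_iff_lt_one_right hp0).1 r23']
    have hxp : (p : ℤ) ∣ x' := by
      obtain ⟨c, c0, c1, c2, c3, c4⟩ := h11
      simp only [l10, l20, l21, l30, l31, l32, l40, l41, l42, l43, d0, d1, d2, d3, e0, e1, e2, e3,
        e4, hx', hy, hz, hu, hv, hw, hw0] at c0 c1 c2 c3 c4
      have c4' : c 4 = 0 := by linear_combination c4
      have c3' : c 3 = 0 := mul_left_cancel₀ hp3.ne' (by linear_combination c3 - c4')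
      have c2' : c 2 = 0 := mul_left_cancel₀ hp0.ne' (by linear_combination c2 - c4')
      rw [c2', c3', c4'] at c0 c1
      have c1' : c 1 = p ^ 2 := mul_left_cancel₀ hp2.ne' (by linear_combination c1)
      rw [c1'] at c0
      refine (Nat.prime_iff_prime_int.1 hp).dvd_of_dvd_pow (n := 2)
        ⟨c 0 + x', mul_left_cancel₀ hp2.ne' ?_⟩
      linear_combination -c0
    obtain ⟨x, rfl⟩ := hxp
    have hA : A = candidate p x u v y z := by
      ext i j
      fin_cases i <;> fin_cases j <;> simp [candidate, l10, l20, l21, l30, l31, l32, l40, l41, l42,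
        l43, d0, d1, d2, d3, e0, e1, e2, e3, e4, hx', hy, hz, hu, hv, hw, hw0]
      ring
    rw [hx', ← mul_assoc, ← sq] at r01 r01'
    rw [hy] at r02 r02'
    rw [hz] at r03 r03'
    rw [hu] at r12 r12'
    rw [hv] at r13 r13'
    refine ⟨x, u, v, y, z, ⟨⟨nonneg_of_mul_nonneg_right r01 hp2, ?_⟩,
      ⟨nonneg_of_mul_nonneg_right r12 hp0, ?_⟩, ⟨nonneg_of_mul_nonneg_right r13 hp0, ?_⟩,
      ⟨nonneg_of_mul_nonneg_right r02 hp0, ?_⟩, ⟨nonneg_of_mul_nonneg_right r03 hp0, ?_⟩⟩,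
      (forall_inColSpan_candidate_iff _ _ _ _ _ _ hp0.ne').1 (hA ▸ hmul), hA⟩
    · exact lt_of_mul_lt_mul_left (by linarith) hp2.le
    · exact lt_of_mul_lt_mul_left (by linarith) hp0.le
    · exact lt_of_mul_lt_mul_left (by linarith) hp0.le
    · exact lt_of_mul_lt_mul_left (by linarith) hp0.le
    · exact lt_of_mul_lt_mul_left (by linarith) hp0.le
  · rintro ⟨x, u, v, y, z, hr, hc, rfl⟩
    exact isIrreducibleSubringMatrix_candidate hp hr hc

theorem candidate_injective {p : ℤ} (hp : p ≠ 0) {x u v y z x' u' v' y' z' : ℤ}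
    (h : candidate p x u v y z = candidate p x' u' v' y' z') :
    x = x' ∧ u = u' ∧ v = v' ∧ y = y' ∧ z = z' := by
  have h01 := congr_fun₂ h 0 1
  have h12 := congr_fun₂ h 1 2
  have h13 := congr_fun₂ h 1 3
  have h02 := congr_fun₂ h 0 2
  have h03 := congr_fun₂ h 0 3
  simp [candidate, hp] at h01 h12 h13 h02 h03
  tauto

theorem add_mul_inj {p a b c d : ℕ} (ha : a < p) (hc : c < p) (h : a + p * b = c + p * d) :
    a = c ∧ b = d := by
  have hac : a = c := by
    simpa [Nat.add_mul_mod_self_left, Nat.mod_eq_of_lt ha, Nat.mod_eq_of_lt hc] using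
      congr_arg (· % p) h
  subst hac
  exact ⟨rfl, Nat.eq_of_mul_eq_mul_left (by omega) (Nat.add_left_cancel h)⟩

theorem g_3213 (p : ℕ) (hp : p.Prime) :
    (gComp p ![3, 2, 1, 3] : ℤ) =
      5 * (p : ℤ) ^ 4 - 4 * (p : ℤ) ^ 3 + 2 * (p : ℤ) ^ 2 := by
  have : Fact p.Prime := ⟨hp⟩
  have hdvd : ∀ a : ℤ, (p : ℤ) ∣ a ↔ (a : ZMod p) = 0 := fun a =>
    (ZMod.intCast_zmod_eq_zero_iff_dvd a p).symm
  let S := Finset.univ.filter fun t : ZMod p × ZMod p × ZMod p × ZMod p × ZMod p =>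
    t.2.2.2.1 ^ 2 - t.2.2.2.1 = t.1 * (t.2.1 ^ 2 - t.2.1) ∧
    t.2.2.2.1 * t.2.2.2.2 = t.1 * t.2.1 * t.2.2.1 ∧
    t.2.2.2.2 ^ 2 = t.1 * t.2.2.1 ^ 2
  let f : S × Fin p × Fin p →
      {A : Matrix (Fin 5) (Fin 5) ℤ // IsIrreducibleSubringMatrix p ![3, 2, 1, 3] A} := fun t =>
    ⟨candidate p t.1.1.1.val t.1.1.2.1.val t.1.1.2.2.1.val
      ((t.1.1.2.2.2.1.val + p * t.2.1 : ℕ) : ℤ) ((t.1.1.2.2.2.2.val + p * t.2.2 : ℕ) : ℤ), by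
    obtain ⟨⟨⟨x, u, v, y, z⟩, ht⟩, i, j⟩ := t
    rw [isIrreducibleSubringMatrix_iff hp]
    simp only [S, Finset.mem_filter, Finset.mem_univ, true_and] at ht
    have hlt : ∀ (a : ZMod p) (b : Fin p), a.val + p * b < p ^ 2 := by
      intro a b
      have := a.val_lt
      have := b.2
      nlinarith
    refine ⟨_, _, _, _, _, ⟨⟨by positivity, by exact_mod_cast x.val_lt⟩,
      ⟨by positivity, by exact_mod_cast u.val_lt⟩, ⟨by positivity, by exact_mod_cast v.val_lt⟩,
      ⟨by positivity, by exact_mod_cast hlt y i⟩, ⟨by positivity, by exact_mod_cast hlt z j⟩⟩,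
      ?_, rfl⟩
    simp only [hdvd, Int.cast_sub, Int.cast_mul, Int.cast_pow, Int.cast_natCast, Int.cast_add,
      Nat.cast_add, Nat.cast_mul, ZMod.natCast_zmod_val, CharP.cast_eq_zero, zero_mul, add_zero,
      sub_eq_zero]
    exact ht⟩
  have hf : Function.Bijective f := by
    constructor
    · rintro ⟨⟨⟨x, u, v, y, z⟩, ht⟩, i, j⟩ ⟨⟨⟨x', u', v', y', z'⟩, ht'⟩, i', j'⟩ h
      obtain ⟨hx, hu, hv, hy, hz⟩ := candidate_injective (by exact_mod_cast hp.ne_zero)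
        (congr_arg Subtype.val h)
      obtain ⟨hy, hi⟩ := add_mul_inj y.val_lt y'.val_lt (Int.natCast_inj.1 hy)
      obtain ⟨hz, hj⟩ := add_mul_inj z.val_lt z'.val_lt (Int.natCast_inj.1 hz)
      simp only [Prod.mk.injEq, Subtype.mk.injEq]
      exact ⟨⟨ZMod.val_injective p (Int.natCast_inj.1 hx),
        ZMod.val_injective p (Int.natCast_inj.1 hu),
        ZMod.val_injective p (Int.natCast_inj.1 hv), ZMod.val_injective p hy,
        ZMod.val_injective p hz⟩, Fin.ext hi, Fin.ext hj⟩
    · rintro ⟨A, hA⟩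
      obtain ⟨x, u, v, y, z, ⟨⟨hx, hx'⟩, ⟨hu, hu'⟩, ⟨hv, hv'⟩, ⟨hy, hy'⟩, ⟨hz, hz'⟩⟩, hc, rfl⟩ :=
        (isIrreducibleSubringMatrix_iff hp A).1 hA
      lift x to ℕ using hx
      lift u to ℕ using hu
      lift v to ℕ using hv
      lift y to ℕ using hy
      lift z to ℕ using hz
      norm_cast at hx' hu' hv' hy' hz'
      simp only [hdvd, Int.cast_sub, Int.cast_mul, Int.cast_pow, Int.cast_natCast,
        sub_eq_zero] at hc
      refine ⟨⟨⟨((x : ZMod p), (u : ZMod p), (v : ZMod p), (y : ZMod p), (z : ZMod p)),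
        Finset.mem_filter.2 ⟨Finset.mem_univ _, hc⟩⟩,
        ⟨y / p, Nat.div_lt_of_lt_mul (by rwa [← sq])⟩,
        ⟨z / p, Nat.div_lt_of_lt_mul (by rwa [← sq])⟩⟩, Subtype.ext ?_⟩
      simp only [f, ZMod.val_natCast, Nat.mod_eq_of_lt hx', Nat.mod_eq_of_lt hu',
        Nat.mod_eq_of_lt hv', Nat.mod_add_div]
  have hcard : gComp p ![3, 2, 1, 3] = S.card * (p * p) := by
    rw [gComp, ← Nat.card_eq_of_bijective f hf]
    simp
  have hS := card_solutions (ZMod p)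
  rw [ZMod.card] at hS
  rw [hcard]
  push_cast
  rw [hS]
  ring
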